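/- (Genus-one, one-pole case of Theorem 1.1.) For every integer k ≥ 1, the number of (k+1)-tuples (τ1, …, τ_{k+1}) of transpositions in S_k whose product τ1⋯τ_{k+1} is a single k-cycle equals (k − 1) · (k + 1)! · k^k / 24. Equivalently, the genus-one one-pole Hurwitz number is h_{1;k} = (k − 1)(k + 1)! k^k / (24 · k!). -/

import Mathlib

open Equiv

/-- The cycle type of a permutation of `Fin k` where fixed points are counted as
cycles of length 1 (Mathlib's `cycleType` records only nontrivial cycles).
A permutation `σ` of `Fin k` is a `k`-cycle iff `fullCycleType σ = {k}`. -/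
def fullCycleType {k : ℕ} (σ : Perm (Fin k)) : Multiset ℕ :=
  σ.cycleType + Multiset.replicate (k - σ.support.card) 1

/-- `N_{g,k}`: the number of `(k + 2g - 1)`-tuples of transpositions in `S_k` whose
product is a single `k`-cycle. -/
noncomputable def oneHoleCount (g k : ℕ) : ℕ :=
  Nat.card {τ : Fin (k + 2 * g - 1) → Perm (Fin k) //
    (∀ i, (τ i).IsSwap) ∧ fullCycleType (List.ofFn τ).prod = ({k} : Multiset ℕ)}

/-- The one-pole Hurwitz number `h_{g;k} = N_{g,k} / k!`. -/
noncomputable def oneHoleHurwitzNumber (g k : ℕ) : ℚ :=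
  (oneHoleCount g k : ℚ) / (k.factorial : ℚ)

section AlternatingSums

open Finset

/-- The alternating binomial sum `∑ j, (-1) ^ j * C(n, j) * (y - j) ^ m`. -/
def altBinomSum (n m : ℕ) (y : ℚ) : ℚ :=
  ∑ j ∈ range (n + 1), (-1) ^ j * (n.choose j : ℚ) * (y - j) ^ m

lemma altBinomSum_zero_left (m : ℕ) (y : ℚ) : altBinomSum 0 m y = y ^ m := by
  simp [altBinomSum]

lemma altBinomSum_succ_zero (n : ℕ) (y : ℚ) : altBinomSum (n + 1) 0 y = 0 := by
  have h := Int.alternating_sum_range_choose_of_ne (n := n + 1) (by omega)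
  simp only [altBinomSum, pow_zero, mul_one]
  exact_mod_cast h

lemma altBinomSum_succ_succ (n m : ℕ) (y : ℚ) :
    altBinomSum (n + 1) (m + 1) y =
      y * altBinomSum (n + 1) m y + (n + 1) * altBinomSum n m (y - 1) := by
  have h1 : altBinomSum (n + 1) (m + 1) y = y * altBinomSum (n + 1) m y -
      ∑ j ∈ range (n + 1 + 1), (-1) ^ j * ((n + 1).choose j : ℚ) * j * (y - j) ^ m := by
    simp only [altBinomSum, mul_sum, ← sum_sub_distrib]
    refine sum_congr rfl fun j _ => ?_
    ring
  rw [h1, sum_range_succ', altBinomSum.eq_def n m, mul_sum]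
  simp only [Nat.cast_zero, mul_zero, zero_mul, add_zero, sub_eq_add_neg, ← sum_neg_distrib]
  congr 1
  refine sum_congr rfl fun j _ => ?_
  have h2 : ((n + 1).choose (j + 1) : ℚ) * (j + 1) = (n + 1) * n.choose j := by
    exact_mod_cast (Nat.add_one_mul_choose_eq n j).symm
  push_cast
  rw [pow_succ, show y + -((j : ℚ) + 1) = y + -1 + -j by ring]
  linear_combination (-1 : ℚ) ^ j * (y + -1 + -(j : ℚ)) ^ m * h2

lemma altBinomSum_of_lt (n m : ℕ) (h : m < n) (y : ℚ) : altBinomSum n m y = 0 := by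
  induction m generalizing n y with
  | zero => obtain ⟨n, rfl⟩ := Nat.exists_eq_add_one.2 h; exact altBinomSum_succ_zero n y
  | succ m ih =>
    obtain ⟨n, rfl⟩ := Nat.exists_eq_add_one.2 (Nat.zero_lt_of_lt h)
    rw [altBinomSum_succ_succ, ih _ (by omega), ih _ (by omega)]
    ring

lemma altBinomSum_self (n : ℕ) (y : ℚ) : altBinomSum n n y = n.factorial := by
  induction n generalizing y with
  | zero => simp [altBinomSum_zero_left]
  | succ n ih =>
    rw [altBinomSum_succ_succ, ih, altBinomSum_of_lt _ _ (by omega), Nat.factorial_succ]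
    push_cast
    ring

lemma altBinomSum_add_one (n : ℕ) (y : ℚ) :
    altBinomSum n (n + 1) y = (n + 1).factorial * (y - n / 2) := by
  induction n generalizing y with
  | zero => simp [altBinomSum_zero_left]
  | succ n ih =>
    rw [altBinomSum_succ_succ, ih, altBinomSum_self, Nat.factorial_succ (n + 1)]
    push_cast
    ring

lemma altBinomSum_add_two (n : ℕ) (y : ℚ) :
    altBinomSum n (n + 2) y = (n + 2).factorial * ((y - n / 2) ^ 2 / 2 + n / 24) := by
  induction n generalizing y with
  | zero =>
    simp [altBinomSum_zero_left, Nat.factorial]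
    ring
  | succ n ih =>
    rw [altBinomSum_succ_succ, ih, altBinomSum_add_one, Nat.factorial_succ (n + 2)]
    push_cast
    ring

end AlternatingSums

section PermutationDeterminant

open Finset Polynomial Matrix

lemma det_eq_sum_prod_row {n R : Type*} [Fintype n] [DecidableEq n] [CommRing R]
    (M : Matrix n n R) : M.det = ∑ π : Perm n, (Perm.sign π : ℤ) * ∏ a, M a (π a) := by
  rw [← det_transpose, det_apply']
  rfl

lemma derivative_det {n R : Type*} [Fintype n] [DecidableEq n] [CommRing R]
    (M : Matrix n n R[X]) :
    derivative M.det = ∑ i, (M.updateRow i fun b => derivative (M i b)).det := by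
  simp only [det_eq_sum_prod_row, derivative_sum, derivative_intCast_mul,
    derivative_prod_finset, mul_sum]
  rw [sum_comm]
  refine sum_congr rfl fun i _ => sum_congr rfl fun π _ => ?_
  rw [← mul_prod_erase _ _ (mem_univ i), updateRow_self, mul_comm (derivative _)]
  congr 2
  refine prod_congr rfl fun a ha => ?_
  rw [updateRow_ne (ne_of_mem_erase ha)]

variable {k : ℕ}

/-- The matrix `1 - X P` where `P` is the permutation matrix of `σ`. -/
noncomputable def oneSubXPerm (σ : Perm (Fin k)) : Matrix (Fin k) (Fin k) ℚ[X] :=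
  of fun a => Pi.single a 1 - Pi.single (σ a) X

lemma oneSubXPerm_row (σ : Perm (Fin k)) (a : Fin k) :
    oneSubXPerm σ a = Pi.single a 1 - Pi.single (σ a) X := rfl

lemma sum_row_oneSubXPerm (σ : Perm (Fin k)) :
    ∑ a, oneSubXPerm σ a = fun _ => 1 - X := by
  funext b
  simp only [oneSubXPerm_row, Finset.sum_apply, Pi.sub_apply, sum_sub_distrib, Pi.single_apply]
  rw [Equiv.sum_comp σ (fun a => if b = a then (X : ℚ[X]) else 0)]
  simp

lemma det_updateRow_ones (σ : Perm (Fin k)) (i : Fin k) :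
    (1 - X) * ((oneSubXPerm σ).updateRow i fun _ => 1).det = (oneSubXPerm σ).det := by
  rw [← det_updateRow_smul]
  have h := det_updateRow_sum (oneSubXPerm σ) i fun _ => 1
  simp only [one_smul, sum_row_oneSubXPerm] at h
  rw [← h]
  congr 2
  funext b
  simp

lemma derivative_det_oneSubXPerm (σ : Perm (Fin k)) :
    derivative (oneSubXPerm σ).det =
      -∑ i, ((oneSubXPerm σ).updateRow i (Pi.single (σ i) 1)).det := by
  rw [derivative_det, ← sum_neg_distrib]
  refine sum_congr rfl fun i _ => ?_
  rw [← neg_one_mul, ← det_updateRow_smul]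
  congr 2
  funext b
  simp only [oneSubXPerm_row, Pi.sub_apply, Pi.single_apply, Pi.smul_apply, smul_eq_mul]
  split_ifs <;> simp

lemma det_oneSubXPerm_mul_swap (σ : Perm (Fin k)) (i j : Fin k) :
    (oneSubXPerm (σ * swap i j)).det = (oneSubXPerm σ).det +
      ((oneSubXPerm σ).updateRow i (Pi.single (σ i) X - Pi.single (σ j) X)).det +
      ((oneSubXPerm σ).updateRow j (Pi.single (σ j) X - Pi.single (σ i) X)).det := by
  rcases eq_or_ne i j with rfl | hij
  · have h : ((oneSubXPerm σ).updateRow i 0).det = 0 :=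
      det_eq_zero_of_row_eq_zero i (by simp)
    simp [h, Perm.one_def.symm]
  set M := oneSubXPerm σ with hM
  set w : Fin k → ℚ[X] := Pi.single (σ i) X - Pi.single (σ j) X with hw
  have h1 : oneSubXPerm (σ * swap i j) = (M.updateRow i (M i + w)).updateRow j (M j + -w) := by
    funext a
    rcases eq_or_ne a j with rfl | haj
    · simp [hM, hw, oneSubXPerm_row]
    rcases eq_or_ne a i with rfl | hai
    · simp [hM, hw, oneSubXPerm_row, haj]
    · simp [hM, oneSubXPerm_row, haj, hai, swap_apply_of_ne_of_ne]
  have h2 : ((M.updateRow i w).updateRow j (-w)).det = 0 := by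
    rw [← neg_one_smul ℚ[X] w, det_updateRow_smul, det_zero_of_row_eq hij (by simp [hij]),
      mul_zero]
  have h3 : ∀ u, (M.updateRow i u).updateRow j (M j) = M.updateRow i u := fun u => by
    rw [show M j = M.updateRow i u j by simp [hij.symm], updateRow_eq_self]
  rw [h1, det_updateRow_add, h3, det_updateRow_add, updateRow_eq_self,
    updateRow_comm _ hij, det_updateRow_add, updateRow_comm _ hij.symm _ w, h2,
    updateRow_comm _ hij.symm, updateRow_eq_self]
  rw [add_zero, hw, neg_sub]

open scoped Classical in
lemma sum_swap {A : Type*} [AddCommMonoid A] (h : Perm (Fin k) → A) :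
    ∑ i, ∑ j, h (swap i j) = k • h 1 + 2 • ∑ t with t.IsSwap, h t := by
  have hoff : ∀ p ∈ (univ : Finset (Fin k)).offDiag,
      swap p.1 p.2 ∈ univ.filter fun t : Perm (Fin k) => t.IsSwap := by
    intro p hp
    rw [mem_offDiag] at hp
    exact mem_filter.2 ⟨mem_univ _, p.1, p.2, hp.2.2, rfl⟩
  rw [← sum_product', ← diag_union_offDiag, sum_union (disjoint_diag_offDiag _), sum_diag]
  congr 1
  · simp [Perm.one_def]
  rw [← sum_fiberwise_of_maps_to hoff, smul_sum]
  refine sum_congr rfl fun t ht => ?_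
  obtain ⟨x, y, hxy, rfl⟩ := (mem_filter.1 ht).2
  have hfib : (univ : Finset (Fin k)).offDiag.filter (fun p => Equiv.swap p.1 p.2 = Equiv.swap x y) =
      {(x, y), (y, x)} := by
    ext ⟨a, b⟩
    simp only [mem_filter, mem_offDiag, mem_univ, true_and, mem_insert, mem_singleton,
      Prod.mk.injEq]
    constructor
    · rintro ⟨hab, h⟩
      have ha := congrArg (· a) h
      simp only [swap_apply_left] at ha
      rcases eq_or_ne a x with rfl | hax
      · simp_all
      rcases eq_or_ne a y with rfl | hay
      · simp_all
      · rw [swap_apply_of_ne_of_ne hax hay] at ha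
        exact absurd ha.symm hab
    · rintro (⟨rfl, rfl⟩ | ⟨rfl, rfl⟩)
      · exact ⟨hxy, rfl⟩
      · exact ⟨hxy.symm, swap_comm _ _⟩
  rw [sum_congr rfl fun p hp => congrArg h (mem_filter.1 hp).2, hfib, sum_const,
    card_pair (by simp [hxy])]

lemma sum_det_oneSubXPerm_mul_swap (σ : Perm (Fin k)) :
    (1 - X : ℚ[X]) * ∑ i, ∑ j, (oneSubXPerm (σ * swap i j)).det =
      (1 - X) * ((k : ℚ[X]) ^ 2 * (oneSubXPerm σ).det) -
        2 * ((k : ℚ[X]) * X * (1 - X) * derivative (oneSubXPerm σ).det + (k : ℚ[X]) * X * (oneSubXPerm σ).det) := by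
  have hrow : ∀ i, ∑ j, ((oneSubXPerm σ).updateRow i
      (Pi.single (σ i) X - Pi.single (σ j) X)).det =
      (k : ℚ[X]) * X * ((oneSubXPerm σ).updateRow i (Pi.single (σ i) 1)).det -
        X * ((oneSubXPerm σ).updateRow i fun _ => 1).det := by
    intro i
    have hsingle : ∀ b : Fin k, (Pi.single b X : Fin k → ℚ[X]) = (X : ℚ[X]) • Pi.single b 1 := by
      intro b; rw [← Pi.single_smul]; simp
    have hsub : ∀ u v : Fin k → ℚ[X], ((oneSubXPerm σ).updateRow i (u - v)).det =
        ((oneSubXPerm σ).updateRow i u).det - ((oneSubXPerm σ).updateRow i v).det :=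
      fun u v => (detRowAlternating : (Fin k → ℚ[X]) [⋀^Fin k]→ₗ[ℚ[X]] ℚ[X]).map_update_sub
        (oneSubXPerm σ) i u v
    have hsum : ∑ j, ((oneSubXPerm σ).updateRow i (Pi.single (σ j) 1)).det =
        ((oneSubXPerm σ).updateRow i fun _ => 1).det := by
      have h1 : (fun _ => 1 : Fin k → ℚ[X]) = ∑ j, Pi.single (σ j) 1 := by
        rw [Equiv.sum_comp σ (fun j => (Pi.single j 1 : Fin k → ℚ[X]))]
        exact (univ_sum_single _).symm
      rw [h1]
      exact ((detRowAlternating : (Fin k → ℚ[X]) [⋀^Fin k]→ₗ[ℚ[X]] ℚ[X]).map_update_sum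
        univ i (fun j => Pi.single (σ j) 1) (oneSubXPerm σ)).symm
    simp only [hsub, sum_sub_distrib, hsingle, det_updateRow_smul, ← mul_sum, hsum]
    simp
    ring
  simp only [det_oneSubXPerm_mul_swap, sum_add_distrib]
  rw [sum_comm (f := fun i j => ((oneSubXPerm σ).updateRow j _).det)]
  simp only [hrow, sum_sub_distrib, ← mul_sum]
  have hD : ∑ i, ((oneSubXPerm σ).updateRow i (Pi.single (σ i) 1)).det =
      -derivative (oneSubXPerm σ).det := by
    rw [derivative_det_oneSubXPerm, neg_neg]
  have hones : (1 - X) * ∑ i, ((oneSubXPerm σ).updateRow i fun _ => 1).det =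
      (k : ℚ[X]) * (oneSubXPerm σ).det := by
    simp [mul_sum, det_updateRow_ones]
  rw [hD]
  simp only [sum_const, card_univ, Fintype.card_fin, nsmul_eq_mul]
  linear_combination (-2 * X) * hones

open scoped Classical in
lemma sum_isSwap_det_oneSubXPerm (σ : Perm (Fin k)) :
    (1 - X : ℚ[X]) * ∑ t with t.IsSwap, (oneSubXPerm (σ * t)).det =
      (1 - X) * (C ((k : ℚ) * (k - 1) / 2) * (oneSubXPerm σ).det) -
        ((k : ℚ[X]) * X * (1 - X) * derivative (oneSubXPerm σ).det + (k : ℚ[X]) * X * (oneSubXPerm σ).det) := by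
  have h1 := sum_det_oneSubXPerm_mul_swap σ
  rw [sum_swap fun t => (oneSubXPerm (σ * t)).det] at h1
  simp only [nsmul_eq_mul, mul_one] at h1
  have h2 : 2 * C ((k : ℚ) * (k - 1) / 2) = (k : ℚ[X]) * (k - 1) := by
    rw [← C_ofNat, ← C_mul, mul_div_cancel₀ _ (by norm_num)]
    simp
  have h3 : (2 : ℚ[X]) ≠ 0 := two_ne_zero
  apply mul_left_cancel₀ h3
  push_cast at h1
  linear_combination h1 - (1 - X) * (oneSubXPerm σ).det * h2

lemma eval_derivative_det_of_not_sameCycle (σ : Perm (Fin k))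
    (h : ∀ i, ∃ x, ¬ σ.SameCycle i x) :
    (derivative (oneSubXPerm σ).det).eval 1 = 0 := by
  rw [derivative_det_oneSubXPerm, eval_neg, eval_finsetSum, neg_eq_zero]
  refine sum_eq_zero fun i _ => ?_
  rw [← coe_evalRingHom, RingHom.map_det]
  classical
  obtain ⟨v, hv⟩ : ∃ v : Fin k → ℚ, ∀ b, v b = if σ.SameCycle i b then 0 else 1 :=
    ⟨_, fun _ => rfl⟩
  refine exists_mulVec_eq_zero_iff.1 ⟨v, ?_, ?_⟩
  · obtain ⟨x, hx⟩ := h i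
    intro h0
    simpa [hv, hx] using congrFun h0 x
  funext a
  rcases eq_or_ne a i with rfl | hai
  · have h0 : v (σ a) = 0 := by simp [hv, Perm.SameCycle.refl]
    simp [mulVec, dotProduct, Pi.single_apply, apply_ite (eval (1 : ℚ)), h0]
  · have h0 : v (σ a) = v a := by simp [hv]
    simp [mulVec, dotProduct, Pi.single_apply, hai, oneSubXPerm_row, apply_ite (eval (1 : ℚ)),
      sub_mul, sum_sub_distrib, h0]

lemma det_oneSubXPerm_of_isCycle (σ : Perm (Fin k)) (hσ : σ.IsCycle) (hs : σ.support = univ) :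
    (oneSubXPerm σ).det = 1 - X ^ k := by
  have hne : ∀ a, σ a ≠ a := fun a => Perm.mem_support.1 (hs ▸ mem_univ a)
  have hcycle : ∀ a b, σ.SameCycle a b := fun a b => hσ.sameCycle (hne a) (hne b)
  have h1 : (1 : Perm (Fin k)) ≠ σ := hσ.ne_one.symm
  rw [det_eq_sum_prod_row, sum_eq_add 1 σ h1]
  · have hid : ∏ a, oneSubXPerm σ a a = 1 :=
      prod_eq_one fun a _ => by simp [oneSubXPerm_row, (hne a).symm]
    have hprod : ∏ a, oneSubXPerm σ a (σ a) = (-X) ^ k := by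
      simp [oneSubXPerm_row, hne]
    rw [hprod, hσ.sign, hs]
    simp only [Perm.sign_one, Perm.one_apply, hid, card_univ, Fintype.card_fin]
    rw [neg_pow (X : ℚ[X]) k]
    push_cast
    have h4 : ((-1 : ℚ[X]) ^ k) * (-1) ^ k = 1 := by rw [← mul_pow]; simp
    linear_combination -(X : ℚ[X]) ^ k * h4
  · intro π _ hπ
    by_contra hprod
    have hπσ : ∀ a, π a = a ∨ π a = σ a := by
      intro a
      by_contra! ha
      refine right_ne_zero_of_mul hprod (prod_eq_zero (mem_univ a) ?_)
      simp [oneSubXPerm_row, ha.1, ha.2]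
    by_cases hfix : ∃ a, π a = σ a
    · obtain ⟨a, ha⟩ := hfix
      refine hπ.2 (Equiv.ext fun b => ?_)
      have step : ∀ c, π c = σ c → π (σ c) = σ (σ c) := fun c hc =>
        (hπσ (σ c)).resolve_left fun h => hne c (π.injective (h.trans hc.symm))
      obtain ⟨n, -, rfl⟩ := (hcycle a b).exists_pow_eq'
      induction n with
      | zero => exact ha
      | succ n ih => rw [pow_succ', Perm.mul_apply]; exact step _ ih
    · push Not at hfix
      exact hπ.1 (Equiv.ext fun a => (hπσ a).resolve_right (hfix a))
  · simp
  · simp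

end PermutationDeterminant

lemma fullCycleType_eq_singleton_iff {k : ℕ} (hk : 2 ≤ k) (σ : Perm (Fin k)) :
    fullCycleType σ = {k} ↔ σ.IsCycle ∧ σ.support = Finset.univ := by
  constructor
  · intro h
    have hmem : k ∈ σ.cycleType := by
      have : k ∈ fullCycleType σ := by simp [h]
      rcases Multiset.mem_add.1 this with h' | h'
      · exact h'
      · have := Multiset.eq_of_mem_replicate h'
        omega
    have hle : ({k} : Multiset ℕ) ≤ σ.cycleType := Multiset.singleton_le.2 hmem
    have heq : σ.cycleType = {k} :=
      le_antisymm (h ▸ Multiset.le_add_right _ _) hle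
    refine ⟨Perm.card_cycleType_eq_one.1 (by simp [heq]), ?_⟩
    rw [← Finset.card_eq_iff_eq_univ, ← Perm.sum_cycleType, heq]
    simp
  · rintro ⟨hσ, hs⟩
    simp [fullCycleType, hσ.cycleType, hs]

lemma eval_derivative_det_oneSubXPerm {k : ℕ} (hk : 2 ≤ k) (σ : Perm (Fin k)) :
    (Polynomial.derivative (oneSubXPerm σ).det).eval 1 =
      if fullCycleType σ = {k} then -(k : ℚ) else 0 := by
  split_ifs with h
  · rw [fullCycleType_eq_singleton_iff hk] at h
    rw [det_oneSubXPerm_of_isCycle σ h.1 h.2]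
    simp [Polynomial.derivative_X_pow]
  · refine eval_derivative_det_of_not_sameCycle σ ?_
    by_contra! hc
    obtain ⟨i, hi⟩ := hc
    have hne : ∀ y, σ y ≠ y := by
      have : Nontrivial (Fin k) := Fin.nontrivial_iff_two_le.2 hk
      intro y hy
      obtain ⟨z, hz⟩ := exists_ne y
      exact hz ((((hi y).symm.trans (hi z)).eq_of_left hy).symm)
    refine h ((fullCycleType_eq_singleton_iff hk σ).2 ⟨⟨i, hne i, fun y _ => hi y⟩, ?_⟩)
    ext y
    simp [hne y]

section Count

open Finset Polynomial
open scoped Classical in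
/-- The sum of `det (1 - X P)` over all `r`-tuples of transpositions, where `P` is the
permutation matrix of the product of the tuple. -/
noncomputable def swapTupleDetSum (k r : ℕ) : ℚ[X] :=
  ∑ τ : Fin r → Perm (Fin k) with ∀ i, (τ i).IsSwap, (oneSubXPerm (List.ofFn τ).prod).det

lemma swapTupleDetSum_zero (k : ℕ) : swapTupleDetSum k 0 = (1 - X) ^ k := by
  have h : oneSubXPerm (1 : Perm (Fin k)) = Matrix.diagonal fun _ => 1 - X := by
    ext a b : 2
    rcases eq_or_ne a b with rfl | h
    · simp [oneSubXPerm_row]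
    · simp [oneSubXPerm_row, h, h.symm]
  simp [swapTupleDetSum, h]

lemma swapTupleDetSum_succ (k r : ℕ) :
    (1 - X : ℚ[X]) * swapTupleDetSum k (r + 1) =
      (1 - X) * (C ((k : ℚ) * (k - 1) / 2) * swapTupleDetSum k r) -
        ((k : ℚ[X]) * X * (1 - X) * derivative (swapTupleDetSum k r) + (k : ℚ[X]) * X * swapTupleDetSum k r) := by
  classical
  have h : swapTupleDetSum k (r + 1) =
      ∑ τ : Fin r → Perm (Fin k) with ∀ i, (τ i).IsSwap,
        ∑ t with t.IsSwap, (oneSubXPerm ((List.ofFn τ).prod * t)).det := by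
    simp only [swapTupleDetSum, sum_filter]
    rw [← Equiv.sum_comp (Fin.snocEquiv fun _ => Perm (Fin k)), Fintype.sum_prod_type_right]
    refine sum_congr rfl fun τ _ => ?_
    split_ifs with hτ
    · refine sum_congr rfl fun t _ => ?_
      rw [List.ofFn_succ']
      simp [Fin.forall_fin_succ', hτ, Fin.snocEquiv, -List.ofFn_succ]
    · refine sum_eq_zero fun t _ => ?_
      simp only [Fin.forall_fin_succ', Fin.snocEquiv_apply, Fin.snoc_castSucc]
      simp [hτ]
  rw [h, mul_sum]
  simp only [sum_isSwap_det_oneSubXPerm, swapTupleDetSum, sum_sub_distrib, sum_add_distrib,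
    ← mul_sum, derivative_sum]

/-- The quotient of `swapTupleDetSum (n + 1) r` by `1 - X`. -/
noncomputable def swapTupleHookSum (n r : ℕ) : ℚ[X] :=
  ∑ j ∈ range (n + 1),
    C ((((n : ℚ) + 1) * n / 2 - (n + 1) * j) ^ r * ((-1) ^ j * n.choose j)) * X ^ j

lemma swapTupleHookSum_zero (n : ℕ) : swapTupleHookSum n 0 = (1 - X) ^ n := by
  rw [sub_eq_neg_add, add_pow, swapTupleHookSum]
  refine sum_congr rfl fun j _ => ?_
  rw [neg_pow]
  simp
  ring

lemma swapTupleHookSum_succ (n r : ℕ) :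
    swapTupleHookSum n (r + 1) = C (((n : ℚ) + 1) * n / 2) * swapTupleHookSum n r -
      ((n : ℚ[X]) + 1) * X * derivative (swapTupleHookSum n r) := by
  simp only [swapTupleHookSum, mul_sum, derivative_sum, ← sum_sub_distrib]
  refine sum_congr rfl fun j _ => ?_
  have h : X * derivative (X ^ j : ℚ[X]) = C (j : ℚ) * X ^ j := by
    rcases j with _ | j
    · simp
    · rw [derivative_X_pow, pow_succ]; simp; ring
  rw [derivative_C_mul, pow_succ]
  have h2 : C (((n : ℚ) + 1) * n / 2 - (n + 1) * j) =
      C (((n : ℚ) + 1) * n / 2) - (n + 1) * C (j : ℚ) := by simp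
  rw [mul_right_comm, C_mul (b := ((n : ℚ) + 1) * n / 2 - (n + 1) * j), h2]
  linear_combination ((n : ℚ[X]) + 1) *
    C ((((n : ℚ) + 1) * n / 2 - (n + 1) * j) ^ r * ((-1) ^ j * n.choose j)) * h

lemma swapTupleDetSum_eq (n r : ℕ) :
    swapTupleDetSum (n + 1) r = (1 - X) * swapTupleHookSum n r := by
  induction r with
  | zero => rw [swapTupleDetSum_zero, swapTupleHookSum_zero, pow_succ']
  | succ r ih =>
    have hX : (1 - X : ℚ[X]) ≠ 0 := fun h => by simpa using congrArg (eval 0) h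
    apply mul_left_cancel₀ hX
    rw [swapTupleDetSum_succ, ih, swapTupleHookSum_succ, derivative_mul]
    simp only [derivative_sub, derivative_one, derivative_X, Nat.cast_add, Nat.cast_one,
      add_sub_cancel_right]
    ring

lemma eval_swapTupleHookSum (n r : ℕ) :
    (swapTupleHookSum n r).eval 1 = ((n : ℚ) + 1) ^ r * altBinomSum n r (n / 2) := by
  rw [swapTupleHookSum, eval_finsetSum, altBinomSum, mul_sum]
  refine sum_congr rfl fun j _ => ?_
  rw [show ((n : ℚ) + 1) * n / 2 - (n + 1) * j = (n + 1) * (n / 2 - j) by ring, mul_pow]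
  simp
  ring

/-- The number of `r`-tuples of transpositions in `S_{n+1}` whose product is an
`(n+1)`-cycle, as an alternating binomial sum. -/
lemma card_swapTuples_prod_fullCycle (n r : ℕ) (hn : 1 ≤ n) :
    ((n : ℚ) + 1) * Nat.card {τ : Fin r → Perm (Fin (n + 1)) //
      (∀ i, (τ i).IsSwap) ∧ fullCycleType (List.ofFn τ).prod = ({n + 1} : Multiset ℕ)} =
      (n + 1) ^ r * altBinomSum n r (n / 2) := by
  classical
  have h1 : (derivative (swapTupleDetSum (n + 1) r)).eval 1 =
      -(((n : ℚ) + 1) ^ r * altBinomSum n r (n / 2)) := by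
    rw [swapTupleDetSum_eq, derivative_mul, ← eval_swapTupleHookSum]
    simp
  rw [swapTupleDetSum, derivative_sum, eval_finsetSum,
    sum_congr rfl fun τ _ => eval_derivative_det_oneSubXPerm (by omega) _, ← sum_filter,
    filter_filter, sum_const, nsmul_eq_mul] at h1
  rw [Nat.card_eq_fintype_card, Fintype.card_subtype]
  push_cast at h1
  linear_combination -h1

end Count

lemma oneHoleCount_one_eq (k : ℕ) (hk : 1 ≤ k) :
    (oneHoleCount 1 k : ℚ)
      = ((k : ℚ) - 1) * ((k + 1).factorial : ℚ) * (k : ℚ) ^ k / 24 := by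
  obtain ⟨n, rfl⟩ := Nat.exists_eq_add_of_le' hk
  rcases Nat.eq_zero_or_pos n with rfl | hn
  · have : IsEmpty {τ : Fin (0 + 1 + 2 * 1 - 1) → Perm (Fin (0 + 1)) //
        (∀ i, (τ i).IsSwap) ∧ fullCycleType (List.ofFn τ).prod = ({0 + 1} : Multiset ℕ)} := by
      refine ⟨fun ⟨τ, h, _⟩ => ?_⟩
      obtain ⟨x, y, hxy, -⟩ := h ⟨0, by norm_num⟩
      omega
    rw [oneHoleCount, Nat.card_of_isEmpty]
    simp
  · have h := card_swapTuples_prod_fullCycle n (n + 2) hn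
    rw [altBinomSum_add_two] at h
    have hn0 : ((n : ℚ) + 1) ≠ 0 := by positivity
    apply mul_left_cancel₀ hn0
    change ((n : ℚ) + 1) * (oneHoleCount 1 (n + 1) : ℚ) = _ at h
    rw [h]
    push_cast
    ring

/-- Genus-one, one-pole case of Theorem 1.1: the number of `(k+1)`-tuples of
transpositions in `S_k` whose product is a `k`-cycle equals `(k-1)(k+1)! k^k / 24`;
equivalently `h_{1;k} = (k-1)(k+1)! k^k / (24 k!)`. -/
theorem one_hole_genus_one (k : ℕ) (hk : 1 ≤ k) :
    (oneHoleCount 1 k : ℚ)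
      = ((k : ℚ) - 1) * ((k + 1).factorial : ℚ) * (k : ℚ) ^ k / 24 ∧
    oneHoleHurwitzNumber 1 k
      = ((k : ℚ) - 1) * ((k + 1).factorial : ℚ) * (k : ℚ) ^ k
          / (24 * (k.factorial : ℚ)) := by
  refine ⟨oneHoleCount_one_eq k hk, ?_⟩
  rw [oneHoleHurwitzNumber, oneHoleCount_one_eq k hk, div_div]
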